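/- Assume α, β > 1/2. Then there exists C(α,β) > 0 such that sup_{x∈[-1,1]} |I_j(x)| ≤ C(α,β)/√(j+1) for all j ≥ 0, where I_j(x) = ∫_{-1}^x P_j^{(α,β)}(t) ω_{α-1,β-1}(t) dt. -/

import Mathlib

/-- The Jacobi polynomial `P_n^{(a,b)}` via its explicit hypergeometric sum. -/
noncomputable def jacobiP (n : ℕ) (a b : ℝ) (x : ℝ) : ℝ :=
  Real.Gamma (a + n + 1) / ((n.factorial : ℝ) * Real.Gamma (a + b + n + 1)) *
    ∑ m ∈ Finset.range (n + 1),
      (n.choose m : ℝ) * (Real.Gamma (a + b + n + m + 1) / Real.Gamma (a + m + 1)) *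
        ((x - 1) / 2) ^ m

/-- The Jacobi weight `ω_{a,b}(t) = (1-t)^a (1+t)^b`. -/
noncomputable def jacobiW (a b t : ℝ) : ℝ := (1 - t) ^ a * (1 + t) ^ b


/-- Interior-to-endpoint control for solutions of the Jacobi equation near the singular point `1`,
by a maximum principle for the derivative. -/
lemma jacobi_ode_endpoint_control {a b c l : ℝ} {y y' y'' : ℝ → ℝ} (ha : 1 / 2 < a) (hb : 1 / 2 < b)
    (hc : 0 < c) (hc1 : c ≤ 1) (hcab : c * (a + b + 2) ≤ 1) (hl : 1 ≤ l)
    (hy : ∀ x, HasDerivAt y (y' x) x) (hy' : ∀ x, HasDerivAt y' (y'' x) x)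
    (hode : ∀ x, (1 - x ^ 2) * y'' x + (b - a - (a + b + 2) * x) * y' x + l * y x = 0)
    {x z : ℝ} (hx : x ∈ Set.Icc (1 - c / l) 1) (hz : z ∈ Set.Icc (1 - c / l) 1) :
    |y x| ≤ 2 * |y z| ∧ |y' x| ≤ l * |y z| := by
  have hl0 : 0 < l := by linarith
  have hcl : 0 < c / l := by positivity
  have hclc : c / l ≤ c := div_le_self hc.le hl
  have hne : (Set.Icc (1 - c / l) 1).Nonempty := ⟨x, hx⟩
  have hcy : Continuous y := continuous_iff_continuousAt.2 fun x => (hy x).continuousAt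
  have hcy' : Continuous y' := continuous_iff_continuousAt.2 fun x => (hy' x).continuousAt
  obtain ⟨m, hm, hmax⟩ := isCompact_Icc.exists_isMaxOn hne hcy.abs.continuousOn
  obtain ⟨p, hp, hpmax⟩ := isCompact_Icc.exists_isMaxOn hne (hcy'.pow 2).continuousOn
  have hM : ∀ t ∈ Set.Icc (1 - c / l) 1, |y t| ≤ |y m| := fun t ht => hmax ht
  have hP : ∀ t ∈ Set.Icc (1 - c / l) 1, y' t ^ 2 ≤ y' p ^ 2 := fun t ht => hpmax ht
  have hderiv : (1 - p) * (y' p * y'' p) ≤ 0 := by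
    have h1 : HasFDerivWithinAt (fun t => y' t ^ 2) _ (Set.Icc (1 - c / l) 1) p :=
      ((hy' p).pow 2).hasFDerivAt.hasFDerivWithinAt
    have h2 := hpmax.localize.hasFDerivWithinAt_nonpos h1
      (sub_mem_posTangentConeAt_of_segment_subset (y := 1)
        ((convex_Icc _ _).segment_subset hp ⟨by linarith, le_rfl⟩))
    simp at h2
    nlinarith
  have hcoef : b - a - (a + b + 2) * p ≤ -2 := by
    have : (a + b + 2) * (1 - p) ≤ (a + b + 2) * c :=
      mul_le_mul_of_nonneg_left (by linarith [hp.1]) (by linarith)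
    linarith
  have hpp : 2 * y' p ^ 2 ≤ l * |y m| * |y' p| := by
    have h3 : (1 - p ^ 2) * (y' p * y'' p) ≤ 0 := by
      have : (1 - p ^ 2) * (y' p * y'' p) = (1 + p) * ((1 - p) * (y' p * y'' p)) := by ring
      rw [this]
      exact mul_nonpos_of_nonneg_of_nonpos (by linarith [hp.1]) hderiv
    have h4 : l * (y p * y' p) ≤ l * (|y m| * |y' p|) := by
      refine mul_le_mul_of_nonneg_left ?_ hl0.le
      calc y p * y' p ≤ |y p * y' p| := le_abs_self _
        _ = |y p| * |y' p| := abs_mul _ _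
        _ ≤ _ := mul_le_mul_of_nonneg_right (hM p hp) (abs_nonneg _)
    have h5 : (1 - p ^ 2) * (y' p * y'' p) + (b - a - (a + b + 2) * p) * y' p ^ 2
        + l * (y p * y' p) = 0 := by linear_combination y' p * hode p
    nlinarith [sq_nonneg (y' p)]
  have hD : ∀ t ∈ Set.Icc (1 - c / l) 1, |y' t| ≤ l * |y m| / 2 := by
    intro t ht
    refine (sq_le_sq.1 (hP t ht)).trans ?_
    rcases (abs_nonneg (y' p)).eq_or_lt with h | h
    · rw [← h]; positivity
    · rw [← sq_abs] at hpp
      have : 2 * |y' p| ≤ l * |y m| := by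
        by_contra! hlt
        nlinarith
      linarith
  have hmz : |y m| ≤ 2 * |y z| := by
    have h6 := (convex_Icc (1 - c / l) 1).norm_image_sub_le_of_norm_hasDerivWithin_le
      (fun t _ => (hy t).hasDerivWithinAt) hD hz hm
    simp only [Real.norm_eq_abs] at h6
    have h7 : |m - z| ≤ c / l := by
      rw [abs_le]; constructor <;> linarith [hm.1, hm.2, hz.1, hz.2]
    have h8 : l * |y m| / 2 * |m - z| ≤ |y m| / 2 := by
      calc l * |y m| / 2 * |m - z| ≤ l * |y m| / 2 * (c / l) := by gcongr
        _ = c * (|y m| / 2) := by field_simp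
        _ ≤ _ := mul_le_of_le_one_left (by positivity) hc1
    have h9 := abs_sub_abs_le_abs_sub (y m) (y z)
    linarith
  refine ⟨(hM x hx).trans hmz, (hD x hx).trans ?_⟩
  nlinarith

/-- Liouville–Green energy of a solution of the Jacobi equation. -/
noncomputable def jacobiEnergy (a b l : ℝ) (y y' : ℝ → ℝ) (x : ℝ) : ℝ :=
  (1 - x) ^ (a + 1 / 2) * (1 + x) ^ (b + 1 / 2) *
    (l * y x ^ 2 + (1 - x ^ 2) *
      (y' x + (-(a + 1 / 2) / (1 - x) + (b + 1 / 2) / (1 + x)) * y x / 2) ^ 2)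


lemma jacobiEnergy_deriv_identity {a b l x U V Y Z T : ℝ} (h1 : 1 - x ≠ 0) (h2 : 1 + x ≠ 0)
    (h : (1 - x) * (1 + x) * T + (b - a - (a + b + 2) * x) * Z + l * Y = 0) :
    (-1 * (a + 1 / 2) * (U / (1 - x)) * V + U * (1 * (b + 1 / 2) * (V / (1 + x)))) *
        (l * Y ^ 2 + (1 - x) * (1 + x) *
          (Z + (-(a + 1 / 2) / (1 - x) + (b + 1 / 2) / (1 + x)) * Y / 2) ^ 2) +
      U * V *
        (l * (2 * Y * Z) +
          (-(2 * x) * (Z + (-(a + 1 / 2) / (1 - x) + (b + 1 / 2) / (1 + x)) * Y / 2) ^ 2 +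
            (1 - x) * (1 + x) *
              (2 * (Z + (-(a + 1 / 2) / (1 - x) + (b + 1 / 2) / (1 + x)) * Y / 2) *
                (T +
                  (((0 * (1 - x) - -(a + 1 / 2) * -1) / (1 - x) ^ 2 +
                        (0 * (1 + x) - (b + 1 / 2) * 1) / (1 + x) ^ 2) * Y +
                      (-(a + 1 / 2) / (1 - x) + (b + 1 / 2) / (1 + x)) * Z) / 2)))) =
    U * V *
      (Y * (Z + (-(a + 1 / 2) / (1 - x) + (b + 1 / 2) / (1 + x)) * Y / 2) *
        ((-(a + 1 / 2) * (1 + x) ^ 2 - (b + 1 / 2) * (1 - x) ^ 2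
            - x * ((b + 1 / 2) * (1 - x) - (a + 1 / 2) * (1 + x)) +
            ((b + 1 / 2) * (1 - x) - (a + 1 / 2) * (1 + x)) ^ 2 / 2) /
          ((1 - x) * (1 + x)))) := by
  have hr : -(a + 1 / 2) / (1 - x) + (b + 1 / 2) / (1 + x) =
      (b - a - (a + b + 1) * x) / ((1 - x) * (1 + x)) := by
    field_simp
    ring
  have hr' : (0 * (1 - x) - -(a + 1 / 2) * -1) / (1 - x) ^ 2 +
      (0 * (1 + x) - (b + 1 / 2) * 1) / (1 + x) ^ 2 =
      (-(a + 1 / 2) * (1 + x) ^ 2 - (b + 1 / 2) * (1 - x) ^ 2) / ((1 - x) * (1 + x)) ^ 2 := by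
    field_simp
    ring
  have hw : -1 * (a + 1 / 2) * (U / (1 - x)) * V + U * (1 * (b + 1 / 2) * (V / (1 + x))) =
      U * V * ((b - a - (a + b + 1) * x) / ((1 - x) * (1 + x))) := by
    rw [← hr]
    ring
  have hT : T = -((b - a - (a + b + 2) * x) * Z + l * Y) / ((1 - x) * (1 + x)) := by
    rw [eq_div_iff (mul_ne_zero h1 h2)]
    linear_combination h
  rw [hr, hr', hw, hT]
  have hp : (1 - x) * (1 + x) ≠ 0 := mul_ne_zero h1 h2
  generalize (1 - x) * (1 + x) = p at *
  field_simp
  ring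

lemma hasDerivAt_jacobiEnergy {a b l : ℝ} {y y' y'' : ℝ → ℝ}
    (hy : ∀ x, HasDerivAt y (y' x) x) (hy' : ∀ x, HasDerivAt y' (y'' x) x)
    (hode : ∀ x, (1 - x ^ 2) * y'' x + (b - a - (a + b + 2) * x) * y' x + l * y x = 0)
    {x : ℝ} (hx : x ∈ Set.Ioo (-1 : ℝ) 1) :
    HasDerivAt (jacobiEnergy a b l y y')
      ((1 - x) ^ (a + 1 / 2) * (1 + x) ^ (b + 1 / 2) *
        (y x * (y' x + (-(a + 1 / 2) / (1 - x) + (b + 1 / 2) / (1 + x)) * y x / 2) *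
        ((-(a + 1 / 2) * (1 + x) ^ 2 - (b + 1 / 2) * (1 - x) ^ 2
          - x * ((b + 1 / 2) * (1 - x) - (a + 1 / 2) * (1 + x))
          + ((b + 1 / 2) * (1 - x) - (a + 1 / 2) * (1 + x)) ^ 2 / 2) / (1 - x ^ 2)))) x := by
  have h1 : 0 < 1 - x := by linarith [hx.2]
  have h2 : 0 < 1 + x := by linarith [hx.1]
  have d1 : HasDerivAt (fun t : ℝ => 1 - t) (-1) x := by
    simpa using (hasDerivAt_id x).const_sub 1
  have d2 : HasDerivAt (fun t : ℝ => 1 + t) 1 x := by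
    simpa using (hasDerivAt_id x).const_add 1
  have d3 := d1.rpow_const (p := a + 1 / 2) (Or.inl h1.ne')
  have d4 := d2.rpow_const (p := b + 1 / 2) (Or.inl h2.ne')
  have d5 : HasDerivAt (fun t : ℝ => 1 - t ^ 2) (-(2 * x)) x := by
    simpa using ((hasDerivAt_id x).pow 2).const_sub 1
  have d6 := (((hasDerivAt_const x (-(a + 1 / 2))).div d1 h1.ne').add
    ((hasDerivAt_const x (b + 1 / 2)).div d2 h2.ne'))
  have d7 := (hy' x).add ((d6.mul (hy x)).div_const 2)
  have d8 : HasDerivAt (jacobiEnergy a b l y y') _ x :=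
    (d3.mul d4).mul ((((hy x).pow 2).const_mul l).add (d5.mul (d7.pow 2)))
  refine d8.congr_deriv ?_
  have e1 : (1 - x) ^ (a + 1 / 2 - 1) = (1 - x) ^ (a + 1 / 2) / (1 - x) := by
    rw [Real.rpow_sub_one h1.ne']
  have e2 : (1 + x) ^ (b + 1 / 2 - 1) = (1 + x) ^ (b + 1 / 2) / (1 + x) := by
    rw [Real.rpow_sub_one h2.ne']
  have e3 : 1 - x ^ 2 = (1 - x) * (1 + x) := by ring
  have e4 := hode x
  simp only [e1, e2, Pi.mul_apply, Pi.add_apply, Pi.div_apply]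
  rw [e3] at e4 ⊢
  generalize (1 - x) ^ (a + 1 / 2) = U
  generalize (1 + x) ^ (b + 1 / 2) = V
  generalize y x = Y at *
  generalize y' x = Z at *
  generalize y'' x = T at *
  simp only [Nat.cast_ofNat, pow_one, Nat.reduceSub]
  exact jacobiEnergy_deriv_identity h1.ne' h2.ne' e4

lemma jacobiEnergy_coeff_bound {a b t : ℝ} (ha : 1 / 2 < a) (hb : 1 / 2 < b)
    (ht : t ∈ Set.Ioo (-1 : ℝ) 1) :
    |-(a + 1 / 2) * (1 + t) ^ 2 - (b + 1 / 2) * (1 - t) ^ 2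
        - t * ((b + 1 / 2) * (1 - t) - (a + 1 / 2) * (1 + t))
        + ((b + 1 / 2) * (1 - t) - (a + 1 / 2) * (1 + t)) ^ 2 / 2| ≤ 16 * (a + b + 1) ^ 2 := by
  obtain ⟨ht1, ht2⟩ := ht
  have hA : (a + 1 / 2) * (1 + t) ^ 2 ≤ (a + 1 / 2) * 4 :=
    mul_le_mul_of_nonneg_left (by nlinarith) (by linarith)
  have hB : (b + 1 / 2) * (1 - t) ^ 2 ≤ (b + 1 / 2) * 4 :=
    mul_le_mul_of_nonneg_left (by nlinarith) (by linarith)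
  have hA0 : 0 ≤ (a + 1 / 2) * (1 + t) ^ 2 := by positivity
  have hB0 : 0 ≤ (b + 1 / 2) * (1 - t) ^ 2 := by positivity
  have hS : |(b + 1 / 2) * (1 - t) - (a + 1 / 2) * (1 + t)| ≤ 2 * (a + b + 1) := by
    rw [abs_le]; constructor <;> nlinarith
  generalize (b + 1 / 2) * (1 - t) - (a + 1 / 2) * (1 + t) = S at *
  have htS : |t * S| ≤ 2 * (a + b + 1) := by
    rw [abs_mul]
    have : |t| ≤ 1 := abs_le.2 ⟨ht1.le, ht2.le⟩
    nlinarith [abs_nonneg S]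
  have hS2 := sq_le_sq' (abs_le.1 hS).1 (abs_le.1 hS).2
  have hS0 := sq_nonneg S
  obtain ⟨h3, h4⟩ := abs_le.1 htS
  have hs : 2 * (a + b + 1) ≤ (a + b + 1) ^ 2 := by nlinarith
  rw [abs_le]
  constructor <;> linarith

lemma jacobiEnergy_le {a b l : ℝ} {y y' y'' : ℝ → ℝ} (ha : 1 / 2 < a) (hb : 1 / 2 < b)
    (hl : 1 ≤ l) (hy : ∀ x, HasDerivAt y (y' x) x) (hy' : ∀ x, HasDerivAt y' (y'' x) x)
    (hode : ∀ x, (1 - x ^ 2) * y'' x + (b - a - (a + b + 2) * x) * y' x + l * y x = 0)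
    {x z : ℝ} (hx : -1 < x) (hxz : x ≤ z) (hz : z < 1) :
    jacobiEnergy a b l y y' x ≤ jacobiEnergy a b l y y' z *
      Real.exp (8 * (a + b + 1) ^ 2 / √l * (z / √(1 - z ^ 2) - x / √(1 - x ^ 2))) := by
  set k : ℝ := 8 * (a + b + 1) ^ 2 / √l with hk
  have hmono : MonotoneOn
      (fun t => jacobiEnergy a b l y y' t * Real.exp (k * (t / √(1 - t ^ 2)))) (Set.Ioo (-1) 1) := by
    have hder : ∀ t ∈ Set.Ioo (-1 : ℝ) 1, ∃ d, 0 ≤ d ∧ HasDerivAt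
        (fun t => jacobiEnergy a b l y y' t * Real.exp (k * (t / √(1 - t ^ 2)))) d t := by
      intro t ht
      have h1 : 0 < 1 - t := by linarith [ht.2]
      have h2 : 0 < 1 + t := by linarith [ht.1]
      have hr : 0 < 1 - t ^ 2 := by nlinarith
      have hs : 0 < √(1 - t ^ 2) := Real.sqrt_pos.2 hr
      have hss : √(1 - t ^ 2) ^ 2 = 1 - t ^ 2 := Real.sq_sqrt hr.le
      have hq : 0 < √l := Real.sqrt_pos.2 (by linarith)
      have hqq : √l ^ 2 = l := Real.sq_sqrt (by linarith)
      have d5 : HasDerivAt (fun t : ℝ => 1 - t ^ 2) (-(2 * t)) t := by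
        simpa using ((hasDerivAt_id t).pow 2).const_sub 1
      have d6 : HasDerivAt (fun t : ℝ => t / √(1 - t ^ 2)) (1 / √(1 - t ^ 2) ^ 3) t := by
        refine ((hasDerivAt_id t).div (d5.sqrt hr.ne') hs.ne').congr_deriv ?_
        simp only [id]
        field_simp
        rw [hss]; ring
      have d7 := (hasDerivAt_jacobiEnergy hy hy' hode ht).mul ((d6.const_mul k).exp)
      refine ⟨_, ?_, d7⟩
      rw [jacobiEnergy]
      have hW : 0 ≤ (1 - t) ^ (a + 1 / 2) * (1 + t) ^ (b + 1 / 2) := by positivity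
      generalize (1 - t) ^ (a + 1 / 2) * (1 + t) ^ (b + 1 / 2) = W at hW
      generalize y' t + (-(a + 1 / 2) / (1 - t) + (b + 1 / 2) / (1 + t)) * y t / 2 = w
      set N := -(a + 1 / 2) * (1 + t) ^ 2 - (b + 1 / 2) * (1 - t) ^ 2
          - t * ((b + 1 / 2) * (1 - t) - (a + 1 / 2) * (1 + t))
          + ((b + 1 / 2) * (1 - t) - (a + 1 / 2) * (1 + t)) ^ 2 / 2 with hN
      have hNb : |N| ≤ 16 * (a + b + 1) ^ 2 := jacobiEnergy_coeff_bound ha hb ht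
      have hyw : √l * √(1 - t ^ 2) * (2 * |y t * w|) ≤ l * y t ^ 2 + (1 - t ^ 2) * w ^ 2 := by
        have := two_mul_le_add_sq (√l * |y t|) (√(1 - t ^ 2) * |w|)
        rw [mul_pow, mul_pow, hss, hqq, sq_abs, sq_abs] at this
        rw [abs_mul]
        linarith
      have hfin : |y t * w * (N / (1 - t ^ 2))| ≤
          k * (1 / √(1 - t ^ 2) ^ 3) * (l * y t ^ 2 + (1 - t ^ 2) * w ^ 2) := by
        rw [abs_mul, abs_div, abs_of_pos hr]
        calc |y t * w| * (|N| / (1 - t ^ 2))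
            ≤ |y t * w| * (16 * (a + b + 1) ^ 2 / (1 - t ^ 2)) := by gcongr
          _ = k * (1 / √(1 - t ^ 2) ^ 3) * (√l * √(1 - t ^ 2) * (2 * |y t * w|)) := by
            rw [hk]
            field_simp
            rw [hss]
            ring
          _ ≤ _ := mul_le_mul_of_nonneg_left hyw (by positivity)
      have h5 := (abs_le.1 hfin).1
      have h6 : 0 ≤ W * (y t * w * (N / (1 - t ^ 2)) +
          k * (1 / √(1 - t ^ 2) ^ 3) * (l * y t ^ 2 + (1 - t ^ 2) * w ^ 2)) :=
        mul_nonneg hW (by linarith)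
      have h7 := mul_nonneg h6 (Real.exp_pos (k * (t / √(1 - t ^ 2)))).le
      linarith
    choose! d hd0 hd using hder
    refine monotoneOn_of_deriv_nonneg (convex_Ioo _ _)
      (fun t ht => (hd t ht).continuousAt.continuousWithinAt) ?_ ?_
    · rw [interior_Ioo]
      exact fun t ht => (hd t ht).differentiableAt.differentiableWithinAt
    · rw [interior_Ioo]
      exact fun t ht => (hd t ht).deriv ▸ hd0 t ht
  have h := hmono ⟨hx, by linarith⟩ ⟨by linarith, hz⟩ hxz
  simp only at h
  rw [mul_sub, Real.exp_sub, mul_div_assoc', le_div_iff₀ (Real.exp_pos _)]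
  exact h

lemma jacobi_ode_endpoint_control_neg {a b c l : ℝ} {y y' y'' : ℝ → ℝ} (ha : 1 / 2 < a)
    (hb : 1 / 2 < b) (hc : 0 < c) (hc1 : c ≤ 1) (hcab : c * (a + b + 2) ≤ 1) (hl : 1 ≤ l)
    (hy : ∀ x, HasDerivAt y (y' x) x) (hy' : ∀ x, HasDerivAt y' (y'' x) x)
    (hode : ∀ x, (1 - x ^ 2) * y'' x + (b - a - (a + b + 2) * x) * y' x + l * y x = 0)
    {x z : ℝ} (hx : x ∈ Set.Icc (-1) (-1 + c / l)) (hz : z ∈ Set.Icc (-1) (-1 + c / l)) :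
    |y x| ≤ 2 * |y z| := by
  have h := jacobi_ode_endpoint_control (a := b) (b := a) (y := fun t => y (-t))
    (y' := fun t => -y' (-t)) (y'' := fun t => y'' (-t)) (x := -x) (z := -z) hb ha hc hc1
    (by linarith) hl
    (fun t => by simpa [Function.comp_def] using (hy (-t)).comp t (hasDerivAt_neg t))
    (fun t => ((hy' (-t)).comp t (hasDerivAt_neg t)).neg.congr_deriv (by ring))
    (fun t => by
      have := hode (-t)
      linear_combination this)
    ⟨by linarith [hx.2], by linarith [hx.1]⟩ ⟨by linarith [hz.2], by linarith [hz.1]⟩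
  simpa using h.1

set_option maxHeartbeats 1000000 in
/-- Uniform weighted bound for solutions of the Jacobi equation in terms of the value at `1`. -/
lemma jacobi_ode_weighted_bound {a b : ℝ} (ha : 1 / 2 < a) (hb : 1 / 2 < b) :
    ∃ C : ℝ, 0 < C ∧ ∀ (l : ℝ) (y y' y'' : ℝ → ℝ), 1 ≤ l → (∀ x, HasDerivAt y (y' x) x) →
      (∀ x, HasDerivAt y' (y'' x) x) →
      (∀ x, (1 - x ^ 2) * y'' x + (b - a - (a + b + 2) * x) * y' x + l * y x = 0) →
      ∀ x ∈ Set.Icc (-1 : ℝ) 1, (1 - x) ^ (a + 1 / 2) * (1 + x) ^ (b + 1 / 2) * y x ^ 2 ≤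
        C * (l ^ (-(a + 1 / 2)) * y 1 ^ 2) := by
  obtain ⟨c, hc_def⟩ : ∃ u : ℝ, u = 1 / (a + b + 2) := ⟨_, rfl⟩
  have hc : 0 < c := by rw [hc_def]; positivity
  have hcab : c * (a + b + 2) = 1 := by rw [hc_def]; field_simp
  have hc1 : c ≤ 1 / 2 := by nlinarith
  obtain ⟨D, hD⟩ : ∃ u : ℝ, u = 4 + 2 * c * (1 + (a + b + 1) / c) ^ 2 := ⟨_, rfl⟩
  obtain ⟨X, hX⟩ : ∃ u : ℝ, u = Real.exp (16 * (a + b + 1) ^ 2 / √c) := ⟨_, rfl⟩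
  obtain ⟨C₁, hC₁⟩ : ∃ u : ℝ, u = c ^ (a + 1 / 2) * 2 ^ (b + 1 / 2) * D * X := ⟨_, rfl⟩
  have hD4 : 4 ≤ D := by rw [hD]; linarith [show 0 ≤ 2 * c * (1 + (a + b + 1) / c) ^ 2 by positivity]
  have hX1 : 1 ≤ X := hX ▸ Real.one_le_exp (by positivity)
  have hC₁0 : 0 < C₁ := by rw [hC₁]; positivity
  have hA2 : (1 : ℝ) ≤ 2 ^ (a + 1 / 2) := Real.one_le_rpow (by norm_num) (by linarith)
  refine ⟨4 * 2 ^ (a + 1 / 2) * C₁, by positivity, ?_⟩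
  intro l y y' y'' hl hy hy' hode
  have hl0 : 0 < l := by linarith
  have hcl : 0 < c / l := by positivity
  have hclc : c / l ≤ c := div_le_self hc.le hl
  have hclA : (c / l) ^ (a + 1 / 2) = c ^ (a + 1 / 2) * l ^ (-(a + 1 / 2)) := by
    rw [Real.div_rpow hc.le hl0.le, Real.rpow_neg hl0.le, div_eq_mul_inv]
  have h1mem : (1 : ℝ) ∈ Set.Icc (1 - c / l) 1 := ⟨by linarith, le_rfl⟩
  have h2mem : 1 - c / l ∈ Set.Icc (1 - c / l) 1 := ⟨le_rfl, by linarith⟩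
  have right : ∀ x ∈ Set.Icc (1 - c / l) 1,
      (1 - x) ^ (a + 1 / 2) * (1 + x) ^ (b + 1 / 2) * y x ^ 2 ≤
        C₁ * (l ^ (-(a + 1 / 2)) * y 1 ^ 2) := by
    intro x hx
    have h3 := (jacobi_ode_endpoint_control ha hb hc (by linarith) hcab.le hl hy hy' hode
      hx h1mem).1
    have h4 : y x ^ 2 ≤ D * X * y 1 ^ 2 := by
      have : |y x| ^ 2 ≤ (2 * |y 1|) ^ 2 := pow_le_pow_left₀ (abs_nonneg _) h3 2
      rw [mul_pow, sq_abs, sq_abs] at this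
      have : 4 ≤ D * X := by nlinarith
      nlinarith [sq_nonneg (y 1)]
    have h5 : (1 - x) ^ (a + 1 / 2) ≤ (c / l) ^ (a + 1 / 2) :=
      Real.rpow_le_rpow (by linarith [hx.2]) (by linarith [hx.1]) (by linarith)
    have h6 : (1 + x) ^ (b + 1 / 2) ≤ 2 ^ (b + 1 / 2) :=
      Real.rpow_le_rpow (by linarith [hx.1]) (by linarith [hx.2]) (by linarith)
    have h7 : 0 ≤ 1 + x := by linarith [hx.1]
    calc (1 - x) ^ (a + 1 / 2) * (1 + x) ^ (b + 1 / 2) * y x ^ 2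
        ≤ (c / l) ^ (a + 1 / 2) * 2 ^ (b + 1 / 2) * (D * X * y 1 ^ 2) := by gcongr
      _ = C₁ * (l ^ (-(a + 1 / 2)) * y 1 ^ 2) := by rw [hclA, hC₁]; ring
  have hE1 : jacobiEnergy a b l y y' (1 - c / l) ≤
      c ^ (a + 1 / 2) * 2 ^ (b + 1 / 2) * D * (l ^ (-(a + 1 / 2)) * y 1 ^ 2) * l := by
    obtain ⟨h3, h4⟩ := jacobi_ode_endpoint_control ha hb hc (by linarith) hcab.le hl hy hy' hode
      h2mem h1mem
    rw [jacobiEnergy]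
    have e1 : 1 - (1 - c / l) = c / l := by ring
    rw [e1]
    have h5 : (1 + (1 - c / l)) ^ (b + 1 / 2) ≤ 2 ^ (b + 1 / 2) :=
      Real.rpow_le_rpow (by linarith) (by linarith) (by linarith)
    have h6 : |-(a + 1 / 2) / (c / l) + (b + 1 / 2) / (1 + (1 - c / l))| ≤
        (a + b + 1) / (c / l) := by
      have h7 : (b + 1 / 2) / (1 + (1 - c / l)) ≤ (b + 1 / 2) / (c / l) := by
        gcongr
        linarith
      have h8 : 0 ≤ (b + 1 / 2) / (1 + (1 - c / l)) := div_nonneg (by linarith) (by linarith)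
      have h9 : 0 ≤ (a + 1 / 2) / (c / l) := by positivity
      have h10 : (a + b + 1) / (c / l) = (a + 1 / 2) / (c / l) + (b + 1 / 2) / (c / l) := by ring
      rw [neg_div, h10, abs_le]
      constructor <;> linarith
    have h11 : |y' (1 - c / l) + (-(a + 1 / 2) / (c / l) + (b + 1 / 2) / (1 + (1 - c / l))) *
        y (1 - c / l) / 2| ≤ l * (1 + (a + b + 1) / c) * |y 1| := by
      refine (abs_add_le _ _).trans ?_
      rw [abs_div, abs_mul, abs_two]
      calc _ ≤ l * |y 1| + (a + b + 1) / (c / l) * (2 * |y 1|) / 2 := by gcongr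
        _ = _ := by field_simp
    have h12 := pow_le_pow_left₀ (abs_nonneg _) h11 2
    rw [sq_abs, mul_pow, sq_abs, mul_pow] at h12
    have h13 : y (1 - c / l) ^ 2 ≤ 4 * y 1 ^ 2 := by
      have : |y (1 - c / l)| ^ 2 ≤ (2 * |y 1|) ^ 2 := pow_le_pow_left₀ (abs_nonneg _) h3 2
      rw [mul_pow, sq_abs, sq_abs] at this
      linarith
    have h15 : 0 ≤ 1 - (1 - c / l) ^ 2 := by
      have : 0 ≤ c / l * (2 - c / l) := mul_nonneg hcl.le (by linarith)
      linarith
    have h14 : 1 - (1 - c / l) ^ 2 ≤ 2 * (c / l) := by linarith [sq_nonneg (c / l)]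
    calc _ ≤ (c / l) ^ (a + 1 / 2) * 2 ^ (b + 1 / 2) * (l * (4 * y 1 ^ 2) +
          2 * (c / l) * (l ^ 2 * (1 + (a + b + 1) / c) ^ 2 * y 1 ^ 2)) := by
          have : 0 ≤ l * y (1 - c / l) ^ 2 + (1 - (1 - c / l) ^ 2) *
              (y' (1 - c / l) + (-(a + 1 / 2) / (c / l) + (b + 1 / 2) / (1 + (1 - c / l))) *
                y (1 - c / l) / 2) ^ 2 := by positivity
          gcongr
      _ = c ^ (a + 1 / 2) * 2 ^ (b + 1 / 2) * D * (l ^ (-(a + 1 / 2)) * y 1 ^ 2) * l := by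
        rw [hclA, hD]
        field_simp
  have middle : ∀ x ∈ Set.Icc (-1 + c / l) (1 - c / l),
      (1 - x) ^ (a + 1 / 2) * (1 + x) ^ (b + 1 / 2) * y x ^ 2 ≤
        C₁ * (l ^ (-(a + 1 / 2)) * y 1 ^ 2) := by
    have hroot : ∀ t ∈ Set.Icc (-1 + c / l) (1 - c / l), |t / √(1 - t ^ 2)| ≤ √l / √c := by
      intro t ht
      have h3 : c / l ≤ 1 - t ^ 2 := by
        have h4 : 0 ≤ (1 - c / l - t) * (t - (-1 + c / l)) :=
          mul_nonneg (by linarith [ht.2]) (by linarith [ht.1])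
        have h5 : c / l * (c / l) ≤ 1 * (c / l) :=
          mul_le_mul_of_nonneg_right (by linarith) hcl.le
        linarith
      have h4 : √c / √l ≤ √(1 - t ^ 2) := by
        rw [← Real.sqrt_div hc.le]
        exact Real.sqrt_le_sqrt h3
      have h5 : |t| ≤ 1 := abs_le.2 ⟨by linarith [ht.1], by linarith [ht.2]⟩
      have h6 : 0 < √c / √l := by positivity
      rw [abs_div, abs_of_nonneg (Real.sqrt_nonneg (1 - t ^ 2))]
      calc |t| / √(1 - t ^ 2) ≤ 1 / (√c / √l) := by gcongr
        _ = _ := by rw [one_div_div]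
    intro x hx
    have h3 := jacobiEnergy_le ha hb hl hy hy' hode (x := x) (z := 1 - c / l) (by linarith [hx.1])
      hx.2 (by linarith)
    have hexp : Real.exp (8 * (a + b + 1) ^ 2 / √l *
        ((1 - c / l) / √(1 - (1 - c / l) ^ 2) - x / √(1 - x ^ 2))) ≤ X := by
      rw [hX]
      refine Real.exp_le_exp.2 ?_
      have h4 := (abs_le.1 (hroot x hx)).1
      have h5 := (abs_le.1 (hroot (1 - c / l) ⟨by linarith, le_rfl⟩)).2
      calc _ ≤ 8 * (a + b + 1) ^ 2 / √l * (2 * (√l / √c)) := by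
            gcongr
            linarith
        _ = _ := by
          have : √l ≠ 0 := by positivity
          field_simp
          ring
    have hx1 : 0 ≤ 1 - x := by linarith [hx.2]
    have hx2 : 0 ≤ 1 + x := by linarith [hx.1]
    have h6 : (1 - x) ^ (a + 1 / 2) * (1 + x) ^ (b + 1 / 2) * y x ^ 2 * l ≤
        jacobiEnergy a b l y y' x := by
      rw [jacobiEnergy, mul_assoc, mul_comm (y x ^ 2) l]
      gcongr
      have : 0 ≤ 1 - x ^ 2 := by linarith [mul_nonneg hx1 hx2]
      exact le_add_of_nonneg_right (by positivity)
    have h7 : jacobiEnergy a b l y y' x ≤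
        c ^ (a + 1 / 2) * 2 ^ (b + 1 / 2) * D * (l ^ (-(a + 1 / 2)) * y 1 ^ 2) * l * X :=
      h3.trans (mul_le_mul hE1 hexp (Real.exp_pos _).le (by positivity))
    refine le_of_mul_le_mul_right (h6.trans (h7.trans_eq ?_)) hl0
    rw [hC₁]; ring
  have hC₁C : C₁ * (l ^ (-(a + 1 / 2)) * y 1 ^ 2) ≤
      4 * 2 ^ (a + 1 / 2) * C₁ * (l ^ (-(a + 1 / 2)) * y 1 ^ 2) := by
    gcongr
    exact le_mul_of_one_le_left hC₁0.le (by linarith)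
  intro x hx
  rcases le_total x (1 - c / l) with hxr | hxr
  · rcases le_total (-1 + c / l) x with hxl | hxl
    · exact (middle x ⟨hxl, hxr⟩).trans hC₁C
    · have h3 := jacobi_ode_endpoint_control_neg ha hb hc (by linarith) hcab.le hl hy hy' hode
        (x := x) (z := -1 + c / l) ⟨hx.1, hxl⟩ ⟨by linarith, le_rfl⟩
      have h4 := middle (-1 + c / l) ⟨le_rfl, by linarith⟩
      have e1 : 1 + (-1 + c / l) = c / l := by ring
      rw [e1] at h4
      have h5 : y x ^ 2 ≤ 4 * y (-1 + c / l) ^ 2 := by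
        have : |y x| ^ 2 ≤ (2 * |y (-1 + c / l)|) ^ 2 := pow_le_pow_left₀ (abs_nonneg _) h3 2
        rw [mul_pow, sq_abs, sq_abs] at this
        linarith
      have h6 : (1 : ℝ) ≤ (1 - (-1 + c / l)) ^ (a + 1 / 2) :=
        Real.one_le_rpow (by linarith) (by linarith)
      have h7 : (1 - x) ^ (a + 1 / 2) ≤ 2 ^ (a + 1 / 2) :=
        Real.rpow_le_rpow (by linarith) (by linarith [hx.1]) (by linarith)
      have h8 : (1 + x) ^ (b + 1 / 2) ≤ (c / l) ^ (b + 1 / 2) :=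
        Real.rpow_le_rpow (by linarith [hx.1]) (by linarith) (by linarith)
      have h9 : 0 ≤ 1 + x := by linarith [hx.1]
      calc (1 - x) ^ (a + 1 / 2) * (1 + x) ^ (b + 1 / 2) * y x ^ 2
          ≤ 2 ^ (a + 1 / 2) * (c / l) ^ (b + 1 / 2) * (4 * y (-1 + c / l) ^ 2) := by gcongr
        _ = 4 * 2 ^ (a + 1 / 2) * (1 * (c / l) ^ (b + 1 / 2) * y (-1 + c / l) ^ 2) := by ring
        _ ≤ 4 * 2 ^ (a + 1 / 2) * ((1 - (-1 + c / l)) ^ (a + 1 / 2) * (c / l) ^ (b + 1 / 2) *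
            y (-1 + c / l) ^ 2) := by gcongr
        _ ≤ 4 * 2 ^ (a + 1 / 2) * (C₁ * (l ^ (-(a + 1 / 2)) * y 1 ^ 2)) := by gcongr
        _ = _ := by ring
  · exact (right x ⟨hxr, hx.2⟩).trans hC₁C

/-- The polynomial `p` with `P_n^{(a,b)}(x) = p((x - 1) / 2)`. -/
noncomputable def jacobiPoly (n : ℕ) (a b : ℝ) : Polynomial ℝ :=
  ∑ m ∈ Finset.range (n + 1), Polynomial.C
    (Real.Gamma (a + n + 1) / ((n.factorial : ℝ) * Real.Gamma (a + b + n + 1)) *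
      ((n.choose m : ℝ) * (Real.Gamma (a + b + n + m + 1) / Real.Gamma (a + m + 1)))) *
    Polynomial.X ^ m

lemma jacobiP_eq_eval (n : ℕ) (a b x : ℝ) :
    jacobiP n a b x = (jacobiPoly n a b).eval ((x - 1) / 2) := by
  simp only [jacobiP, jacobiPoly, Polynomial.eval_finsetSum, Polynomial.eval_mul,
    Polynomial.eval_C, Polynomial.eval_pow, Polynomial.eval_X, Finset.mul_sum, mul_assoc]

lemma jacobiPoly_coeff (n : ℕ) (a b : ℝ) (m : ℕ) : (jacobiPoly n a b).coeff m =
    Real.Gamma (a + n + 1) / ((n.factorial : ℝ) * Real.Gamma (a + b + n + 1)) *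
      ((n.choose m : ℝ) * (Real.Gamma (a + b + n + m + 1) / Real.Gamma (a + m + 1))) := by
  simp only [jacobiPoly, Polynomial.finsetSum_coeff, Polynomial.coeff_C_mul_X_pow]
  rw [Finset.sum_ite_eq]
  split_ifs with h
  · rfl
  · rw [Nat.choose_eq_zero_of_lt (by simpa using h)]
    simp

lemma jacobiPoly_coeff_succ {a b : ℝ} (ha : 0 < a) (hb : 0 < b) (n m : ℕ) :
    (m + 1) * (a + m + 1) * (jacobiPoly n a b).coeff (m + 1) =
      (n - m) * (a + b + n + m + 1) * (jacobiPoly n a b).coeff m := by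
  rw [jacobiPoly_coeff, jacobiPoly_coeff]
  have h1 : Real.Gamma (a + b + n + (m + 1 : ℕ) + 1) =
      (a + b + n + m + 1) * Real.Gamma (a + b + n + m + 1) := by
    rw [← Real.Gamma_add_one (by positivity)]; push_cast; ring_nf
  have h2 : Real.Gamma (a + (m + 1 : ℕ) + 1) = (a + m + 1) * Real.Gamma (a + m + 1) := by
    rw [← Real.Gamma_add_one (by positivity)]; push_cast; ring_nf
  have h3 : (n.choose (m + 1) : ℝ) * (m + 1) = n.choose m * (n - m) := by
    rcases le_or_gt m n with h | h
    · rw [← Nat.cast_sub h]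
      exact_mod_cast Nat.choose_succ_right_eq n m
    · rw [Nat.choose_eq_zero_of_lt h, Nat.choose_eq_zero_of_lt (by omega)]
      simp
  rw [h1, h2]
  have h4 : 0 < Real.Gamma (a + m + 1) := Real.Gamma_pos_of_pos (by positivity)
  have h5 : a + m + 1 ≠ 0 := by positivity
  generalize Real.Gamma (a + n + 1) / ((n.factorial : ℝ) * Real.Gamma (a + b + n + 1)) = G
  field_simp
  linear_combination G * h3

open Polynomial in
lemma jacobiPoly_ode {a b : ℝ} (ha : 0 < a) (hb : 0 < b) (n : ℕ) :
    X * derivative (X * derivative (jacobiPoly n a b)) + derivative (X * derivative (jacobiPoly n a b))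
      + C a * derivative (jacobiPoly n a b) + C (a + b + 1) * (X * derivative (jacobiPoly n a b))
      = C (n * (n + a + b + 1)) * jacobiPoly n a b := by
  have hX : ∀ (q : ℝ[X]) (m : ℕ), (X * derivative q).coeff m = m * q.coeff m := by
    intro q m
    cases m with
    | zero => simp
    | succ k => rw [coeff_X_mul, coeff_derivative]; push_cast; ring
  ext m
  simp only [coeff_add, coeff_C_mul, hX]
  rw [coeff_derivative, coeff_derivative, hX]
  have := jacobiPoly_coeff_succ ha hb n m
  push_cast
  linear_combination this

lemma jacobiP_one {a b : ℝ} (ha : 0 < a) (hb : 0 < b) (n : ℕ) :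
    jacobiP n a b 1 = Real.Gamma (a + n + 1) / (n.factorial * Real.Gamma (a + 1)) := by
  rw [jacobiP_eq_eval, sub_self, zero_div, ← Polynomial.coeff_zero_eq_eval_zero, jacobiPoly_coeff]
  have h1 : 0 < Real.Gamma (a + b + n + 1) := Real.Gamma_pos_of_pos (by positivity)
  simp
  field_simp

lemma jacobiP_ode {a b : ℝ} (ha : 0 < a) (hb : 0 < b) (n : ℕ) :
    ∃ y' y'' : ℝ → ℝ, (∀ x, HasDerivAt (jacobiP n a b) (y' x) x) ∧
      (∀ x, HasDerivAt y' (y'' x) x) ∧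
      ∀ x, (1 - x ^ 2) * y'' x + (b - a - (a + b + 2) * x) * y' x
        + n * (n + a + b + 1) * jacobiP n a b x = 0 := by
  have key : ∀ (q : Polynomial ℝ) (x : ℝ), HasDerivAt (fun t : ℝ => q.eval ((t - 1) / 2))
      (q.derivative.eval ((x - 1) / 2) / 2) x := by
    intro q x
    have h := (q.hasDerivAt ((x - 1) / 2)).comp x (((hasDerivAt_id x).sub_const 1).div_const 2)
    refine h.congr_deriv ?_
    ring
  set p := jacobiPoly n a b with hp
  have hfun : jacobiP n a b = fun t : ℝ => p.eval ((t - 1) / 2) :=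
    funext fun x => jacobiP_eq_eval n a b x
  refine ⟨fun x => p.derivative.eval ((x - 1) / 2) / 2,
    fun x => p.derivative.derivative.eval ((x - 1) / 2) / 2 / 2, ?_,
    fun x => (key p.derivative x).div_const 2, ?_⟩
  · rw [hfun]
    exact key p
  · intro x
    have h := congrArg (Polynomial.eval ((x - 1) / 2)) (jacobiPoly_ode ha hb n)
    rw [hfun]
    simp only [Polynomial.derivative_mul, Polynomial.derivative_X, Polynomial.eval_add,
      Polynomial.eval_mul, Polynomial.eval_X, Polynomial.eval_C, Polynomial.eval_one] at h
    simp only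
    rw [← hp] at h
    linear_combination -h

/-- Growth of the endpoint values. -/
lemma exists_jacobiP_one_le {a b : ℝ} (ha : 0 < a) (hb : 0 < b) :
    ∃ C : ℝ, 0 < C ∧ ∀ n : ℕ, 1 ≤ n → |jacobiP n a b 1| ≤ C * (n : ℝ) ^ a := by
  have hG : 0 < Real.Gamma a := Real.Gamma_pos_of_pos ha
  have hprod : ∀ n : ℕ, ∏ j ∈ Finset.range (n + 1), (a + j) =
      Real.Gamma (a + n + 1) / Real.Gamma a := by
    intro n
    induction n with
    | zero => simp [Real.Gamma_add_one ha.ne', hG.ne']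
    | succ k ih =>
      rw [Finset.prod_range_succ, ih, show a + (k + 1 : ℕ) + 1 = (a + k + 1) + 1 by push_cast; ring,
        Real.Gamma_add_one (s := a + k + 1) (by positivity)]
      push_cast
      ring
  have hlim := (Real.GammaSeq_tendsto_Gamma a).inv₀ hG.ne'
  obtain ⟨M, hM⟩ := hlim.bddAbove_range
  have hG1 : 0 < Real.Gamma (a + 1) := Real.Gamma_pos_of_pos (by linarith)
  have hMn : ∀ n : ℕ, (Real.GammaSeq a n)⁻¹ ≤ M := fun n => hM ⟨n, rfl⟩
  refine ⟨(|M| + 1) * Real.Gamma a / Real.Gamma (a + 1), by positivity, fun n hn => ?_⟩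
  have hn0 : (0 : ℝ) < n := by exact_mod_cast hn
  have hGn : 0 < Real.Gamma (a + n + 1) := Real.Gamma_pos_of_pos (by positivity)
  have hf : (0 : ℝ) < n.factorial := by exact_mod_cast n.factorial_pos
  have hna : 0 < (n : ℝ) ^ a := Real.rpow_pos_of_pos hn0 a
  rw [jacobiP_one ha hb, abs_of_pos (by positivity)]
  have h := hMn n
  rw [Real.GammaSeq, hprod, inv_div] at h
  have h2 : Real.Gamma (a + n + 1) / n.factorial ≤ (|M| + 1) * Real.Gamma a * n ^ a := by
    have h3 : Real.Gamma (a + n + 1) / Real.Gamma a / (n ^ a * n.factorial) ≤ |M| + 1 := by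
      linarith [le_abs_self M]
    rw [div_div, div_le_iff₀ (by positivity)] at h3
    rw [div_le_iff₀ hf]
    linarith
  calc _ = Real.Gamma (a + n + 1) / n.factorial / Real.Gamma (a + 1) := by rw [div_div]
    _ ≤ (|M| + 1) * Real.Gamma a * n ^ a / Real.Gamma (a + 1) := by gcongr
    _ = _ := by ring

/-- Uniform weighted bound for Jacobi polynomials. -/
lemma exists_jacobiP_weighted_bound {a b : ℝ} (ha : 1 / 2 < a) (hb : 1 / 2 < b) :
    ∃ C : ℝ, 0 < C ∧ ∀ n : ℕ, ∀ x ∈ Set.Icc (-1 : ℝ) 1,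
      (1 - x) ^ (a + 1 / 2) * (1 + x) ^ (b + 1 / 2) * jacobiP n a b x ^ 2 ≤ C / (n + 1) := by
  have ha0 : 0 < a := by linarith
  have hb0 : 0 < b := by linarith
  obtain ⟨C, hC, hbound⟩ := jacobi_ode_weighted_bound ha hb
  obtain ⟨M, hM, hone⟩ := exists_jacobiP_one_le ha0 hb0
  refine ⟨2 * (C * M ^ 2) + 2 ^ (a + 1 / 2) * 2 ^ (b + 1 / 2) * jacobiP 0 a b 0 ^ 2,
    by positivity, fun n x hx => ?_⟩
  rcases Nat.eq_zero_or_pos n with rfl | hn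
  · have hconst : jacobiP 0 a b x = jacobiP 0 a b 0 := by simp [jacobiP]
    have h1 : (1 - x) ^ (a + 1 / 2) ≤ 2 ^ (a + 1 / 2) :=
      Real.rpow_le_rpow (by linarith [hx.2]) (by linarith [hx.1]) (by linarith)
    have h2 : (1 + x) ^ (b + 1 / 2) ≤ 2 ^ (b + 1 / 2) :=
      Real.rpow_le_rpow (by linarith [hx.1]) (by linarith [hx.2]) (by linarith)
    have h3 : 0 ≤ 1 + x := by linarith [hx.1]
    rw [hconst, Nat.cast_zero, zero_add, div_one]
    have h4 : (1 - x) ^ (a + 1 / 2) * (1 + x) ^ (b + 1 / 2) * jacobiP 0 a b 0 ^ 2 ≤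
        2 ^ (a + 1 / 2) * 2 ^ (b + 1 / 2) * jacobiP 0 a b 0 ^ 2 := by gcongr
    linarith [show 0 ≤ 2 * (C * M ^ 2) by positivity]
  · have hn1 : (1 : ℝ) ≤ n := by exact_mod_cast hn
    have hn0 : (0 : ℝ) < n := by linarith
    have hl : (n : ℝ) ^ 2 ≤ n * (n + a + b + 1) := by nlinarith
    obtain ⟨y', y'', hy, hy', hode⟩ := jacobiP_ode ha0 hb0 n
    have h := hbound (n * (n + a + b + 1)) _ y' y'' (by nlinarith) hy hy' hode x hx
    have h1 : ((n : ℝ) * (n + a + b + 1)) ^ (-(a + 1 / 2)) ≤ ((n : ℝ) ^ 2) ^ (-(a + 1 / 2)) :=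
      Real.rpow_le_rpow_of_nonpos (by positivity) hl (by linarith)
    have h2 : jacobiP n a b 1 ^ 2 ≤ (M * (n : ℝ) ^ a) ^ 2 := by
      rw [← sq_abs]
      exact pow_le_pow_left₀ (abs_nonneg _) (hone n hn) 2
    have h3 : ((n : ℝ) ^ 2) ^ (-(a + 1 / 2)) * (M * (n : ℝ) ^ a) ^ 2 = M ^ 2 / n := by
      have e1 : ((n : ℝ) ^ 2) ^ (-(a + 1 / 2)) = (n : ℝ) ^ (-(2 * a + 1)) := by
        rw [← Real.rpow_natCast, ← Real.rpow_mul hn0.le]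
        congr 1
        push_cast
        ring
      have e2 : ((n : ℝ) ^ a) ^ 2 = (n : ℝ) ^ (2 * a) := by
        rw [← Real.rpow_natCast, ← Real.rpow_mul hn0.le]
        congr 1
        push_cast
        ring
      rw [mul_pow, e1, e2, mul_left_comm, ← Real.rpow_add hn0,
        show -(2 * a + 1) + 2 * a = -1 by ring, Real.rpow_neg_one, div_eq_mul_inv]
    have h4 : 1 / (n : ℝ) ≤ 2 / (n + 1) := by
      rw [div_le_div_iff₀ hn0 (by linarith)]
      linarith
    calc _ ≤ C * (((n : ℝ) ^ 2) ^ (-(a + 1 / 2)) * (M * (n : ℝ) ^ a) ^ 2) := h.trans (by gcongr)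
      _ = C * M ^ 2 * (1 / n) := by rw [h3]; ring
      _ ≤ C * M ^ 2 * (2 / (n + 1)) := by gcongr
      _ = 2 * (C * M ^ 2) / (n + 1) := by ring
      _ ≤ _ := by
        gcongr
        exact le_add_of_nonneg_right (by positivity)

lemma one_sub_rpow_mul_one_add_rpow_le {p q t : ℝ} (ht : t ∈ Set.Ioo (-1 : ℝ) 1) :
    (1 - t) ^ p * (1 + t) ^ q ≤ 2 ^ |q| * (1 - t) ^ p + 2 ^ |p| * (1 + t) ^ q := by
  have key : ∀ s r : ℝ, 1 ≤ s → s ≤ 2 → s ^ r ≤ 2 ^ |r| := fun s r h1 h2 =>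
    (Real.rpow_le_rpow_of_exponent_le h1 (le_abs_self r)).trans
      (Real.rpow_le_rpow (by linarith) h2 (abs_nonneg r))
  have h1 : 0 < 1 - t := by linarith [ht.2]
  have h2 : 0 < 1 + t := by linarith [ht.1]
  have h3 : 0 ≤ (1 - t) ^ p := by positivity
  have h4 : 0 ≤ (1 + t) ^ q := by positivity
  have h5 : (0 : ℝ) ≤ 2 ^ |p| := by positivity
  have h6 : (0 : ℝ) ≤ 2 ^ |q| := by positivity
  rcases le_total 0 t with h | h
  · have := mul_le_mul_of_nonneg_left (key (1 + t) q (by linarith) (by linarith [ht.2])) h3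
    linarith [mul_nonneg h5 h4]
  · have := mul_le_mul_of_nonneg_right (key (1 - t) p (by linarith) (by linarith [ht.1])) h4
    linarith [mul_nonneg h6 h3]

/-- Uniform bound for the weighted primitives `I_j` when `α, β > 1/2`:
`sup_{x∈[-1,1]} |I_j(x)| ≤ C/√(j+1)`. -/
theorem primitive_I_uniform_bound (α β : ℝ) (hα : (1 : ℝ) / 2 < α) (hβ : (1 : ℝ) / 2 < β) :
    ∃ C : ℝ, 0 < C ∧ ∀ j : ℕ, ∀ x ∈ Set.Icc (-1 : ℝ) 1,
      |∫ t in (-1 : ℝ)..x, jacobiP j α β t * jacobiW (α - 1) (β - 1) t| ≤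
        C / Real.sqrt ((j : ℝ) + 1) := by
  obtain ⟨C, hC, hbound⟩ := exists_jacobiP_weighted_bound hα hβ
  set p : ℝ := α / 2 - 5 / 4 with hp
  set q : ℝ := β / 2 - 5 / 4 with hq
  set g : ℝ → ℝ := fun t => 2 ^ |q| * (1 - t) ^ p + 2 ^ |p| * (1 + t) ^ q with hg
  have hint : IntervalIntegrable g MeasureTheory.volume (-1) 1 := by
    have i1 : IntervalIntegrable (fun t : ℝ => (1 - t) ^ p) MeasureTheory.volume (-1) 1 := by
      have := (intervalIntegral.intervalIntegrable_rpow' (a := 2) (b := 0) (r := p)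
        (by linarith)).comp_sub_left 1
      norm_num at this
      exact this
    have i2 : IntervalIntegrable (fun t : ℝ => (1 + t) ^ q) MeasureTheory.volume (-1) 1 := by
      have := (intervalIntegral.intervalIntegrable_rpow' (a := 0) (b := 2) (r := q)
        (by linarith)).comp_add_left 1
      norm_num at this
      exact this
    exact (i1.const_mul _).add (i2.const_mul _)
  have hg0 : ∀ t ∈ Set.Ioc (-1 : ℝ) 1, 0 ≤ g t := by
    intro t ht
    have h1 : 0 ≤ 1 - t := by linarith [ht.2]
    have h2 : 0 ≤ 1 + t := by linarith [ht.1]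
    simp only [hg]
    positivity
  have hI : 0 ≤ ∫ t in (-1 : ℝ)..1, g t := by
    rw [intervalIntegral.integral_of_le (by norm_num)]
    exact MeasureTheory.setIntegral_nonneg measurableSet_Ioc hg0
  refine ⟨√C * ((∫ t in (-1 : ℝ)..1, g t) + 1), by positivity, fun j x hx => ?_⟩
  have hj : (0 : ℝ) < √((j : ℝ) + 1) := by positivity
  have hpt : ∀ t ∈ Set.Ioo (-1 : ℝ) 1, |jacobiP j α β t * jacobiW (α - 1) (β - 1) t| ≤
      √C / √((j : ℝ) + 1) * g t := by
    intro t ht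
    have h1 : 0 < 1 - t := by linarith [ht.2]
    have h2 : 0 < 1 + t := by linarith [ht.1]
    have hW : 0 ≤ (1 - t) ^ ((α + 1 / 2) / 2) * (1 + t) ^ ((β + 1 / 2) / 2) := by positivity
    have h3 : (1 - t) ^ ((α + 1 / 2) / 2) * (1 + t) ^ ((β + 1 / 2) / 2) * |jacobiP j α β t| ≤
        √C / √((j : ℝ) + 1) := by
      rw [← Real.sqrt_div hC.le]
      refine Real.le_sqrt_of_sq_le ?_
      refine le_trans (le_of_eq ?_) (hbound j t ⟨ht.1.le, ht.2.le⟩)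
      rw [mul_pow, mul_pow, sq_abs, ← Real.rpow_mul_natCast h1.le, ← Real.rpow_mul_natCast h2.le]
      norm_num
    have e1 : (1 - t) ^ (α - 1) = (1 - t) ^ ((α + 1 / 2) / 2) * (1 - t) ^ p := by
      rw [← Real.rpow_add h1]
      congr 1
      rw [hp]
      ring
    have e2 : (1 + t) ^ (β - 1) = (1 + t) ^ ((β + 1 / 2) / 2) * (1 + t) ^ q := by
      rw [← Real.rpow_add h2]
      congr 1
      rw [hq]
      ring
    have h4 : 0 ≤ jacobiW (α - 1) (β - 1) t := by
      rw [jacobiW]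
      positivity
    rw [abs_mul, abs_of_nonneg h4, jacobiW, e1, e2]
    calc _ = (1 - t) ^ ((α + 1 / 2) / 2) * (1 + t) ^ ((β + 1 / 2) / 2) * |jacobiP j α β t| *
          ((1 - t) ^ p * (1 + t) ^ q) := by ring
      _ ≤ _ := mul_le_mul h3 (one_sub_rpow_mul_one_add_rpow_le ht) (by positivity) (by positivity)
  have hsub : Set.uIcc (-1) x ⊆ Set.uIcc (-1 : ℝ) 1 := by
    rw [Set.uIcc_of_le hx.1, Set.uIcc_of_le (by norm_num)]
    exact Set.Icc_subset_Icc_right hx.2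
  have hle := intervalIntegral.norm_integral_le_of_norm_le (μ := MeasureTheory.volume)
    (f := fun t => jacobiP j α β t * jacobiW (α - 1) (β - 1) t)
    (g := fun t => √C / √((j : ℝ) + 1) * g t) hx.1 (by
      filter_upwards [MeasureTheory.Measure.ae_ne MeasureTheory.volume (1 : ℝ)] with t ht1 ht
      exact hpt t ⟨ht.1, lt_of_le_of_ne (ht.2.trans hx.2) ht1⟩)
    ((hint.mono_set hsub).const_mul _)
  have hmono : ∫ t in (-1 : ℝ)..x, g t ≤ ∫ t in (-1 : ℝ)..1, g t :=
    intervalIntegral.integral_mono_interval le_rfl hx.1 hx.2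
      (MeasureTheory.ae_restrict_of_forall_mem measurableSet_Ioc hg0) hint
  rw [intervalIntegral.integral_const_mul] at hle
  calc _ ≤ √C / √((j : ℝ) + 1) * ∫ t in (-1 : ℝ)..x, g t := hle
    _ ≤ √C / √((j : ℝ) + 1) * ((∫ t in (-1 : ℝ)..1, g t) + 1) := by
      gcongr
      linarith
    _ = _ := by ring
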